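/- Let $u\in W^{1,2}(B_1)$, $v$ harmonic in $B_{x,\varrho}$ with $\int_{B_{x,\varrho}}|\nabla v|^2\le\int_{B_{x,\varrho}}|\nabla u|^2$, and suppose $\int_{B_{x,\varrho}}|\nabla u-\nabla v|^2\le\theta\int_{B_{x,\varrho}}|\nabla u|^2$ for some $\theta>0$. Then for every $\lambda\ge 1$, $\frac{\lambda^{n-1}}{\varrho^{n-1}}\int_{B_{x,\varrho/\lambda}}|\nabla u|^2\le\Big(2\theta\lambda^{n-1}+\frac{2}{\lambda}\Big)\frac{1}{\varrho^{n-1}}\int_{B_{x,\varrho}}|\nabla u|^2$. -/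

import Mathlib

open MeasureTheory Metric Set Filter
open scoped ENNReal NNReal Topology RealInnerProductSpace symmDiff

/-- Relative perimeter, formalized as the `(n-1)`-dimensional Hausdorff measure of the
topological boundary inside the open set. -/
noncomputable def perim (n : ℕ) (E A : Set (EuclideanSpace ℝ (Fin n))) : ℝ :=
  (μH[(n : ℝ) - 1] (frontier E ∩ A)).toReal

-- The free-interface energy `F^{α,β}_ε(u,E)` in `Ω`.
open Classical in
noncomputable def energy (n : ℕ) (ε α β : ℝ) (Ω : Set (EuclideanSpace ℝ (Fin n)))
    (u : EuclideanSpace ℝ (Fin n) → ℝ) (E : Set (EuclideanSpace ℝ (Fin n))) : ℝ :=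
  ε * perim n E Ω + ∫ x in Ω, (if x ∈ E then β else α) * ‖fderiv ℝ u x‖ ^ 2

/-- `(Λ, r₀)`-minimality of the pair `(u, E)` for `F^{α,β}_ε` in `Ω`. -/
def IsMinimizer (n : ℕ) (ε α β Λ r₀ : ℝ) (Ω : Set (EuclideanSpace ℝ (Fin n)))
    (u : EuclideanSpace ℝ (Fin n) → ℝ) (E : Set (EuclideanSpace ℝ (Fin n))) : Prop :=
  E ⊆ Ω ∧
  ∀ (x : EuclideanSpace ℝ (Fin n)) (r : ℝ), 0 < r → r ≤ r₀ → closedBall x r ⊆ Ω →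
    ∀ (v : EuclideanSpace ℝ (Fin n) → ℝ) (F : Set (EuclideanSpace ℝ (Fin n))),
      E ∆ F ⊆ ball x r → (∀ y, y ∉ ball x r → v y = u y) →
      energy n ε α β Ω u E ≤ energy n ε α β Ω v F + Λ * (volume (E ∆ F)).toReal

/-- Normalized Dirichlet energy `D_u(x, ρ) = ρ^{1-n} ∫_{B_{x,ρ}} |∇u|²`. -/
noncomputable def dirEnergy (n : ℕ) (u : EuclideanSpace ℝ (Fin n) → ℝ)
    (x : EuclideanSpace ℝ (Fin n)) (ρ : ℝ) : ℝ :=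
  ρ ^ (1 - (n : ℤ)) * ∫ y in ball x ρ, ‖fderiv ℝ u y‖ ^ 2

/-- The Laplacian of `f : ℝⁿ → ℝ`, as the sum of the pure second partial derivatives. -/
noncomputable def lap (n : ℕ) (f : EuclideanSpace ℝ (Fin n) → ℝ)
    (y : EuclideanSpace ℝ (Fin n)) : ℝ :=
  ∑ i : Fin n, fderiv ℝ (fun z => fderiv ℝ f z (EuclideanSpace.single i 1)) y
    (EuclideanSpace.single i 1)

/-- the cutoff weight -/
noncomputable def wgt (n : ℕ) (y : EuclideanSpace ℝ (Fin n)) : ℝ := max 0 (1 - ‖y‖ ^ 2)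

lemma wgt_lip (n : ℕ) : LipschitzWith 2 (wgt n) := by
  apply LipschitzWith.of_dist_le_mul
  intro y z
  have h1 : |‖y‖ - ‖z‖| ≤ dist y z := by rw [dist_eq_norm]; exact abs_norm_sub_norm_le y z
  have h2 : |wgt n y - wgt n z| ≤ 2 * |‖y‖ - ‖z‖| := by
    unfold wgt
    have ha := norm_nonneg y
    have hb := norm_nonneg z
    generalize ‖y‖ = a at *
    generalize ‖z‖ = b at *
    have ha' : 1 - a ^ 2 ≤ 0 → 1 ≤ a := fun h => by nlinarith
    have hb' : 1 - b ^ 2 ≤ 0 → 1 ≤ b := fun h => by nlinarith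
    have ha2 : 0 < 1 - a ^ 2 → a < 1 := fun h => by nlinarith
    have hb2 : 0 < 1 - b ^ 2 → b < 1 := fun h => by nlinarith
    rcases le_total a b with h | h
    · rw [abs_of_nonpos (by linarith : a - b ≤ 0)]
      rcases max_cases 0 (1 - a ^ 2) with ⟨e1, h1⟩ | ⟨e1, h1⟩ <;>
      rcases max_cases 0 (1 - b ^ 2) with ⟨e2, h2⟩ | ⟨e2, h2⟩ <;>
      rw [e1, e2, abs_le] <;>
      first | have q1 := ha' h1 | have q1 := ha2 h1
      all_goals first | have q2 := hb' h2 | have q2 := hb2 h2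
      all_goals constructor <;> nlinarith
    · rw [abs_of_nonneg (by linarith : 0 ≤ a - b)]
      rcases max_cases 0 (1 - a ^ 2) with ⟨e1, h1⟩ | ⟨e1, h1⟩ <;>
      rcases max_cases 0 (1 - b ^ 2) with ⟨e2, h2⟩ | ⟨e2, h2⟩ <;>
      rw [e1, e2, abs_le] <;>
      first | have q1 := ha' h1 | have q1 := ha2 h1
      all_goals first | have q2 := hb' h2 | have q2 := hb2 h2
      all_goals constructor <;> nlinarith
  rw [Real.dist_eq]
  push_cast
  linarith

lemma wgt_supp (n : ℕ) : HasCompactSupport (wgt n) := by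
  apply HasCompactSupport.intro (isCompact_closedBall (0 : EuclideanSpace ℝ (Fin n)) 1)
  intro y hy
  have : 1 < ‖y‖ := by simpa using hy
  unfold wgt
  apply max_eq_left
  nlinarith

lemma wgt_lineDeriv_in (n : ℕ) (y w : EuclideanSpace ℝ (Fin n)) (hy : ‖y‖ < 1) :
    lineDeriv ℝ (wgt n) y (-w) = 2 * inner ℝ y w := by
  have h1 : (wgt n) =ᶠ[𝓝 y] fun z => 1 - ‖z‖ ^ 2 := by
    filter_upwards [(isOpen_lt continuous_norm continuous_const).mem_nhds hy] with z hz
    have hz : ‖z‖ < 1 := hz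
    have := norm_nonneg z
    exact max_eq_right (by nlinarith)
  have h2 : HasFDerivAt (fun z : EuclideanSpace ℝ (Fin n) => 1 - ‖z‖ ^ 2)
      (-(2 • innerSL ℝ y)) y := by
    simpa using (hasStrictFDerivAt_norm_sq y).hasFDerivAt.const_sub 1
  have h3 := h2.congr_of_eventuallyEq h1
  rw [(h3.hasLineDerivAt (-w)).lineDeriv]
  simp

lemma wgt_lineDeriv_out (n : ℕ) (y w : EuclideanSpace ℝ (Fin n)) (hy : 1 < ‖y‖) :
    lineDeriv ℝ (wgt n) y w = 0 := by
  have h1 : (wgt n) =ᶠ[𝓝 y] fun z => 0 := by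
    filter_upwards [(isOpen_lt continuous_const continuous_norm).mem_nhds hy] with z hz
    have hz : 1 < ‖z‖ := hz
    exact max_eq_left (by nlinarith)
  have h3 := (hasFDerivAt_const (𝕜 := ℝ) (0:ℝ) y).congr_of_eventuallyEq h1
  rw [(h3.hasLineDerivAt w).lineDeriv]
  simp

lemma cpt_lip {E : Type*} [NormedAddCommGroup E] [NormedSpace ℝ E] [FiniteDimensional ℝ E]
    (G : E → ℝ) (hG : ContDiff ℝ (⊤ : ℕ∞) G) (hc : HasCompactSupport G) :
    ∃ C, LipschitzWith C G :=
  ContDiff.lipschitzWith_of_hasCompactSupport hc hG (by simp)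

/-- partial derivative -/
noncomputable def pd (n : ℕ) (f : EuclideanSpace ℝ (Fin n) → ℝ) (i : Fin n)
    (z : EuclideanSpace ℝ (Fin n)) : ℝ := fderiv ℝ f z (EuclideanSpace.single i 1)

lemma pd_smooth (n : ℕ) (f : EuclideanSpace ℝ (Fin n) → ℝ) (i : Fin n)
    (hf : ContDiff ℝ (⊤ : ℕ∞) f) : ContDiff ℝ (⊤ : ℕ∞) (pd n f i) := by
  unfold pd
  exact (hf.fderiv_right (m := (⊤ : ℕ∞)) (by simp)).clm_apply contDiff_const

lemma pd_supp (n : ℕ) (f : EuclideanSpace ℝ (Fin n) → ℝ) (i : Fin n)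
    (hf : HasCompactSupport f) : HasCompactSupport (pd n f i) :=
  (hf.fderiv ℝ).comp_left (g := fun L : EuclideanSpace ℝ (Fin n) →L[ℝ] ℝ =>
    L (EuclideanSpace.single i 1)) (by simp)

lemma lap_eq (n : ℕ) (f : EuclideanSpace ℝ (Fin n) → ℝ) (y : EuclideanSpace ℝ (Fin n)) :
    lap n f y = ∑ i, pd n (pd n f i) i y := rfl

lemma pd_comm (n : ℕ) (f : EuclideanSpace ℝ (Fin n) → ℝ) (i j : Fin n)
    (hf : ContDiff ℝ (⊤ : ℕ∞) f) (y : EuclideanSpace ℝ (Fin n)) :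
    pd n (pd n f i) j y = pd n (pd n f j) i y := by
  have hd : Differentiable ℝ (fderiv ℝ f) :=
    (hf.fderiv_right (m := (⊤ : ℕ∞)) (by simp)).differentiable (by simp)
  have key : ∀ i j : Fin n, pd n (pd n f i) j y =
      fderiv ℝ (fderiv ℝ f) y (EuclideanSpace.single j 1) (EuclideanSpace.single i 1) := by
    intro i j
    have : HasFDerivAt (pd n f i) _ y :=
      (hd y).hasFDerivAt.clm_apply (hasFDerivAt_const (EuclideanSpace.single i (1:ℝ)) y)
    rw [pd, this.fderiv]
    simp
  rw [key, key]
  have := (hf.contDiffAt (x := y)).isSymmSndFDerivAt (by simp; exact WithTop.coe_le_coe.2 (le_top : (2:ℕ∞) ≤ ⊤))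
  exact this _ _

/-- integration by parts for one coordinate -/
lemma ibp (n : ℕ) (hn : 0 < n) (P : EuclideanSpace ℝ (Fin n) → ℝ) (i : Fin n)
    (hP : ContDiff ℝ (⊤ : ℕ∞) P) (hc : HasCompactSupport P) :
    ∫ y, pd n P i y * wgt n y = ∫ y in ball 0 1, 2 * (y i * P y) := by
  have : Nonempty (Fin n) := ⟨⟨0, hn⟩⟩
  have : Nontrivial (EuclideanSpace ℝ (Fin n)) := inferInstance
  obtain ⟨C, hC⟩ := cpt_lip P hP hc
  have h := hC.integral_lineDeriv_mul_eq (μ := volume) (wgt_lip n) (wgt_supp n)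
    (EuclideanSpace.single i (1:ℝ))
  have hl : ∀ y, lineDeriv ℝ P y (EuclideanSpace.single i (1:ℝ)) = pd n P i y := fun y =>
    (hP.differentiable (by simp)).differentiableAt.lineDeriv_eq_fderiv
  simp_rw [hl] at h
  rw [h, ← integral_indicator measurableSet_ball]
  apply integral_congr_ae
  have hs : ∀ᵐ y : EuclideanSpace ℝ (Fin n), y ∉ sphere (0 : EuclideanSpace ℝ (Fin n)) 1 :=
    measure_eq_zero_iff_ae_notMem.1 (Measure.addHaar_sphere volume _ _)
  filter_upwards [hs] with y hy
  have hy : ‖y‖ ≠ 1 := by simpa using hy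
  rcases lt_or_gt_of_ne hy with h1 | h1
  · rw [wgt_lineDeriv_in n y _ h1, indicator_of_mem (by simpa using h1)]
    simp [EuclideanSpace.inner_single_right]
    ring
  · rw [wgt_lineDeriv_out n y _ h1, indicator_of_notMem (by simpa using h1.le)]
    simp

lemma fderiv_eq_sum_pd (n : ℕ) (f : EuclideanSpace ℝ (Fin n) → ℝ) (z y : EuclideanSpace ℝ (Fin n)) :
    fderiv ℝ f z y = ∑ i, y i * pd n f i z := by
  have h : y = ∑ i, y i • EuclideanSpace.single i (1:ℝ) := by
    have := (EuclideanSpace.basisFun (Fin n) ℝ).sum_repr y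
    simpa using this.symm
  conv_lhs => rw [h]
  simp [pd]

lemma smul_supp (n : ℕ) (G : EuclideanSpace ℝ (Fin n) → ℝ) (hc : HasCompactSupport G)
    (x : EuclideanSpace ℝ (Fin n)) (r : ℝ) (hr : 0 < r) :
    HasCompactSupport (fun y => G (x + r • y)) :=
  hc.comp_homeomorph ((Homeomorph.smulOfNeZero r hr.ne').trans (Homeomorph.addLeft x))

lemma smul_smooth (n : ℕ) (G : EuclideanSpace ℝ (Fin n) → ℝ) (hc : ContDiff ℝ (⊤ : ℕ∞) G)
    (x : EuclideanSpace ℝ (Fin n)) (r : ℝ) :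
    ContDiff ℝ (⊤ : ℕ∞) (fun y => G (x + r • y)) :=
  hc.comp (contDiff_const.add (contDiff_id.const_smul r))

lemma pd_smul (n : ℕ) (G : EuclideanSpace ℝ (Fin n) → ℝ) (hc : ContDiff ℝ (⊤ : ℕ∞) G)
    (x : EuclideanSpace ℝ (Fin n)) (r : ℝ) (i : Fin n) (y : EuclideanSpace ℝ (Fin n)) :
    pd n (fun y => G (x + r • y)) i y = r * pd n G i (x + r • y) := by
  have h1 : HasFDerivAt (fun y : EuclideanSpace ℝ (Fin n) => x + r • y)
      (r • ContinuousLinearMap.id ℝ _) y := ((hasFDerivAt_id y).const_smul r).const_add x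
  have h2 := ((hc.differentiable (by simp)) (x + r • y)).hasFDerivAt
  have h3 : HasFDerivAt (fun y => G (x + r • y)) _ y := h2.comp y h1
  rw [pd, h3.fderiv]
  simp [pd]

lemma flux_nonneg (n : ℕ) (hn : 0 < n) (F : EuclideanSpace ℝ (Fin n) → ℝ)
    (hF : ContDiff ℝ (⊤ : ℕ∞) F) (hc : HasCompactSupport F)
    (x : EuclideanSpace ℝ (Fin n)) (r : ℝ) (hr : 0 < r)
    (hlap : ∀ z ∈ ball x r, 0 ≤ lap n F z) :
    0 ≤ ∫ y in ball 0 1, fderiv ℝ F (x + r • y) y := by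
  set P : Fin n → EuclideanSpace ℝ (Fin n) → ℝ := fun i y => pd n F i (x + r • y) with hP
  have hPs : ∀ i, ContDiff ℝ (⊤ : ℕ∞) (P i) := fun i => smul_smooth n _ (pd_smooth n F i hF) x r
  have hPc : ∀ i, HasCompactSupport (P i) := fun i => smul_supp n _ (pd_supp n F i hc) x r hr
  have hwc : Continuous (wgt n) := (wgt_lip n).continuous
  have h1 : ∀ i, ∫ y, pd n (P i) i y * wgt n y = 2 * ∫ y in ball 0 1, y i * P i y := by
    intro i
    rw [ibp n hn (P i) i (hPs i) (hPc i), integral_const_mul]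
  have h2 : ∫ y in ball 0 1, fderiv ℝ F (x + r • y) y
      = ∑ i, ∫ y in ball 0 1, y i * P i y := by
    rw [← integral_finsetSum]
    · simp_rw [fderiv_eq_sum_pd, hP]
    · intro i _
      apply Integrable.integrableOn
      apply Continuous.integrable_of_hasCompactSupport
      · have := (hPs i).continuous
        fun_prop
      · exact (hPc i).mul_left
  have h3 : 2 * ∫ y in ball 0 1, fderiv ℝ F (x + r • y) y
      = ∫ y, r * lap n F (x + r • y) * wgt n y := by
    rw [h2, Finset.mul_sum]
    simp_rw [← h1]
    rw [← integral_finsetSum]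
    · congr 1
      ext y
      rw [lap_eq, Finset.mul_sum, Finset.sum_mul]
      refine Finset.sum_congr rfl fun i _ => ?_
      rw [← pd_smul n (pd n F i) (pd_smooth n F i hF)]
    · intro i _
      apply Continuous.integrable_of_hasCompactSupport
      · exact (pd_smooth n _ i (hPs i)).continuous.mul hwc
      · exact (wgt_supp n).mul_left
  have h4 : 0 ≤ ∫ y, r * lap n F (x + r • y) * wgt n y := by
    apply integral_nonneg
    intro y
    by_cases hy : ‖y‖ < 1
    · have : x + r • y ∈ ball x r := by
        rw [mem_ball, dist_eq_norm]
        simp [norm_smul, abs_of_pos hr]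
        nlinarith
      have := hlap _ this
      have h5 : 0 ≤ wgt n y := le_max_left _ _
      simp only [Pi.zero_apply]
      positivity
    · have : wgt n y = 0 := max_eq_left (by nlinarith)
      simp [this]
  linarith

lemma avg_mono (n : ℕ) (hn : 0 < n) (F : EuclideanSpace ℝ (Fin n) → ℝ)
    (hF : ContDiff ℝ (⊤ : ℕ∞) F) (hc : HasCompactSupport F)
    (x : EuclideanSpace ℝ (Fin n)) (r R : ℝ) (hr : 0 < r) (hrR : r ≤ R)
    (hlap : ∀ z ∈ ball x R, 0 ≤ lap n F z) :
    ∫ y in ball 0 1, F (x + r • y) ≤ ∫ y in ball 0 1, F (x + R • y) := by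
  obtain ⟨C, hC⟩ := cpt_lip F hF hc
  have hFc := hF.continuous
  have hF' : Continuous (fderiv ℝ F) := hF.continuous_fderiv (by simp)
  have hd : ∀ t : ℝ, HasDerivAt (fun t => ∫ y in ball 0 1, F (x + t • y))
      (∫ y in ball 0 1, fderiv ℝ F (x + t • y) y) t := by
    intro t
    refine (hasDerivAt_integral_of_dominated_loc_of_deriv_le (𝕜 := ℝ) (s := univ)
      (μ := volume.restrict (ball (0 : EuclideanSpace ℝ (Fin n)) 1))
      (F := fun (t : ℝ) y => F (x + t • y)) (F' := fun (t : ℝ) y => fderiv ℝ F (x + t • y) y)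
      (bound := fun _ => (C : ℝ)) univ_mem ?_ ?_ ?_ ?_ ?_ ?_).2
    · refine Eventually.of_forall fun t => ?_
      exact (by fun_prop : Continuous fun y => F (x + t • y)).aestronglyMeasurable
    · have : Continuous fun y => F (x + t • y) := by fun_prop
      exact (this.continuousOn.integrableOn_compact (isCompact_closedBall _ _)).mono_set
        ball_subset_closedBall
    · exact (by fun_prop : Continuous fun y => fderiv ℝ F (x + t • y) y).aestronglyMeasurable
    · refine (ae_restrict_mem measurableSet_ball).mono fun y hy t _ => ?_
      have hy : ‖y‖ < 1 := by simpa using hy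
      have h1 : ‖fderiv ℝ F (x + t • y)‖ ≤ C := norm_fderiv_le_of_lipschitz ℝ hC
      have h2 := (fderiv ℝ F (x + t • y)).le_opNorm y
      have h3 := norm_nonneg y
      have h4 := norm_nonneg (fderiv ℝ F (x + t • y))
      nlinarith
    · have : IntegrableOn (fun _ : EuclideanSpace ℝ (Fin n) => (C:ℝ)) (ball 0 1) :=
        integrableOn_const measure_ball_lt_top.ne
      exact this
    · refine Eventually.of_forall fun y t _ => ?_
      have h1 : HasDerivAt (fun t : ℝ => x + t • y) y t := by
        simpa using ((hasDerivAt_id t).smul_const y).const_add x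
      exact ((hF.differentiable (by simp)) (x + t • y)).hasFDerivAt.comp_hasDerivAt t h1
  have hm : MonotoneOn (fun t : ℝ => ∫ y in ball 0 1, F (x + t • y)) (Icc r R) := by
    apply monotoneOn_of_deriv_nonneg (convex_Icc r R)
    · exact fun t _ => (hd t).continuousAt.continuousWithinAt
    · exact fun t _ => (hd t).differentiableAt.differentiableWithinAt
    · intro t ht
      rw [interior_Icc] at ht
      rw [(hd t).deriv]
      exact flux_nonneg n hn F hF hc x t (hr.trans ht.1)
        fun z hz => hlap z (ball_subset_ball ht.2.le hz)
  exact hm (left_mem_Icc.2 hrR) (right_mem_Icc.2 hrR) hrR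

lemma avg_eq (n : ℕ) (F : EuclideanSpace ℝ (Fin n) → ℝ)
    (x : EuclideanSpace ℝ (Fin n)) (r : ℝ) (hr : 0 < r) :
    ∫ y in ball 0 1, F (x + r • y) = (r ^ n)⁻¹ * ∫ y in ball x r, F y := by
  rw [Measure.setIntegral_comp_smul_of_pos volume (fun y => F (x + y)) _ hr]
  simp only [finrank_euclideanSpace, Fintype.card_fin, smul_eq_mul]
  congr 1
  rw [smul_unitBall hr.ne', Real.norm_of_nonneg hr.le]
  have := (measurePreserving_add_left volume x).setIntegral_preimage_emb
    (MeasurableEquiv.addLeft x).measurableEmbedding F (ball x r)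
  rw [← this]
  congr 2
  ext y
  simp [dist_eq_norm]

/-- squares of derivatives of harmonic functions are subharmonic -/
lemma lap_sq (n : ℕ) (V : EuclideanSpace ℝ (Fin n) → ℝ)
    (hV : ContDiff ℝ (⊤ : ℕ∞) V) (U : Set (EuclideanSpace ℝ (Fin n))) (hU : IsOpen U)
    (hl : ∀ z ∈ U, lap n V z = 0) (i : Fin n) (z : EuclideanSpace ℝ (Fin n)) (hz : z ∈ U) :
    0 ≤ lap n (fun y => pd n V i y ^ 2) z := by
  have hd : ∀ f : EuclideanSpace ℝ (Fin n) → ℝ, ContDiff ℝ (⊤ : ℕ∞) f → Differentiable ℝ f :=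
    fun f hf => hf.differentiable (by simp)
  have hmul : ∀ (f g : EuclideanSpace ℝ (Fin n) → ℝ), ContDiff ℝ (⊤ : ℕ∞) f →
      ContDiff ℝ (⊤ : ℕ∞) g → ∀ j y, pd n (fun y => f y * g y) j y =
        f y * pd n g j y + g y * pd n f j y := by
    intro f g hf hg j y
    have : HasFDerivAt (fun y => f y * g y) _ y :=
      (hd f hf y).hasFDerivAt.mul (hd g hg y).hasFDerivAt
    rw [pd, this.fderiv]
    simp [pd]
  set w := pd n V i with hw
  have hws : ContDiff ℝ (⊤ : ℕ∞) w := pd_smooth n V i hV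
  have hlw : ∑ j, pd n (pd n w j) j z = 0 := by
    have h1 : pd n (lap n V) i z = 0 := by
      have : lap n V =ᶠ[𝓝 z] fun _ => 0 := by
        filter_upwards [hU.mem_nhds hz] with y hy using hl y hy
      rw [pd, this.fderiv_eq]
      simp
    rw [← h1]
    have h2 : HasFDerivAt (lap n V) (∑ j, fderiv ℝ (pd n (pd n V j) j) z) z := by
      have : lap n V = fun y => ∑ j, pd n (pd n V j) j y := by ext y; rfl
      rw [this]
      exact HasFDerivAt.fun_sum fun j _ =>
        (hd _ (pd_smooth n _ j (pd_smooth n V j hV)) z).hasFDerivAt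
    rw [pd, h2.fderiv]
    simp only [_root_.sum_apply]
    refine Finset.sum_congr rfl fun j _ => ?_
    have e : pd n w j = pd n (pd n V j) i := by
      ext y; exact pd_comm n V i j hV y
    rw [e]
    exact pd_comm n (pd n V j) i j (pd_smooth n V j hV) z
  rw [lap_eq]
  have hj : ∀ j, pd n (pd n (fun y => w y ^ 2) j) j z =
      2 * w z * pd n (pd n w j) j z + 2 * (pd n w j z) ^ 2 := by
    intro j
    have hwj := pd_smooth n w j hws
    have e1 : pd n (fun y => w y ^ 2) j = fun y => (w y + w y) * pd n w j y := by
      ext y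
      have := hmul w w hws hws j y
      simp_rw [pow_two]
      rw [this]; ring
    have e2 : pd n (fun y => w y + w y) j z = 2 * pd n w j z := by
      have : HasFDerivAt (fun y => w y + w y) _ z :=
        (hd w hws z).hasFDerivAt.add (hd w hws z).hasFDerivAt
      rw [pd, this.fderiv]
      simp [pd]; ring
    rw [e1, hmul (fun y => w y + w y) (pd n w j) (hws.add hws) hwj j z, e2]
    ring
  simp_rw [hj]
  rw [Finset.sum_add_distrib, ← Finset.mul_sum, hlw]
  simp only [mul_zero, zero_add]
  exact Finset.sum_nonneg fun j _ => by positivity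

lemma grad_sq (n : ℕ) (f : EuclideanSpace ℝ (Fin n) → ℝ) (y : EuclideanSpace ℝ (Fin n)) :
    ‖gradient f y‖ ^ 2 = ∑ i, pd n f i y ^ 2 := by
  rw [EuclideanSpace.real_norm_sq_eq]
  refine Finset.sum_congr rfl fun i _ => ?_
  have : pd n f i y = inner ℝ (gradient f y) (EuclideanSpace.single i (1:ℝ)) := by
    rw [pd, ← toDual_gradient, InnerProductSpace.toDual_apply_apply]
  rw [this, EuclideanSpace.inner_single_right]
  simp

/-- compactly supported global extension of harmonic function -/
lemma harm_mono_lt (n : ℕ) (hn : 0 < n) (x : EuclideanSpace ℝ (Fin n)) (r R ρ : ℝ)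
    (hr : 0 < r) (hrR : r ≤ R) (hR : R < ρ) (v : EuclideanSpace ℝ (Fin n) → ℝ)
    (hsm : ContDiffOn ℝ (⊤ : ℕ∞) v (ball x ρ)) (hharm : ∀ y ∈ ball x ρ, lap n v y = 0) :
    (r ^ n)⁻¹ * ∫ y in ball x r, ‖gradient v y‖ ^ 2 ≤
      (R ^ n)⁻¹ * ∫ y in ball x R, ‖gradient v y‖ ^ 2 := by
  let χ : ContDiffBump x := ⟨R, (R + ρ) / 2, by linarith, by linarith⟩
  set V : EuclideanSpace ℝ (Fin n) → ℝ := fun y => χ y * v y with hV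
  have hVc : HasCompactSupport V := χ.hasCompactSupport.mul_right
  have hVs : ContDiff ℝ (⊤ : ℕ∞) V := by
    rw [contDiff_iff_contDiffAt]
    intro y
    by_cases hy : y ∈ ball x ρ
    · exact χ.contDiff.contDiffAt.mul (hsm.contDiffAt (isOpen_ball.mem_nhds hy))
    · have hy2 : y ∉ tsupport χ := by
        rw [χ.tsupport_eq]
        intro h
        apply hy
        exact closedBall_subset_ball (by change (R + ρ) / 2 < ρ; linarith) h
      have : V =ᶠ[𝓝 y] fun _ => 0 := by
        filter_upwards [(isClosed_tsupport χ).isOpen_compl.mem_nhds hy2] with z hz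
        simp [hV, image_eq_zero_of_notMem_tsupport hz]
      exact contDiffAt_const.congr_of_eventuallyEq this
  have hVv : ∀ y ∈ ball x R, V =ᶠ[𝓝 y] v := by
    intro y hy
    filter_upwards [isOpen_ball.mem_nhds hy] with z hz
    have : χ z = 1 := χ.one_of_mem_closedBall (ball_subset_closedBall hz)
    simp [hV, this]
  have hpd : ∀ y ∈ ball x R, ∀ i, pd n V i y = pd n v i y := by
    intro y hy i
    rw [pd, pd, (hVv y hy).fderiv_eq]
  have hlap : ∀ y ∈ ball x R, lap n V y = 0 := by
    intro y hy
    rw [← hharm y (ball_subset_ball hR.le hy), lap_eq, lap_eq]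
    refine Finset.sum_congr rfl fun i _ => ?_
    have : pd n V i =ᶠ[𝓝 y] pd n v i := by
      filter_upwards [isOpen_ball.mem_nhds hy] with z hz using hpd z hz i
    rw [pd, this.fderiv_eq]
    rfl
  have key : ∀ s, s ≤ R → ∫ y in ball x s, ‖gradient v y‖ ^ 2
      = ∑ i, ∫ y in ball x s, pd n V i y ^ 2 := by
    intro s hs
    rw [← integral_finsetSum]
    · refine setIntegral_congr_fun measurableSet_ball fun y hy => ?_
      simp only [grad_sq]
      exact Finset.sum_congr rfl fun i _ => by rw [hpd y (ball_subset_ball hs hy) i]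
    · intro i _
      have : Continuous fun y => pd n V i y ^ 2 := (pd_smooth n V i hVs).continuous.pow 2
      exact (this.continuousOn.integrableOn_compact (isCompact_closedBall _ _)).mono_set
        ball_subset_closedBall
  rw [key r hrR, key R le_rfl, Finset.mul_sum, Finset.mul_sum]
  refine Finset.sum_le_sum fun i _ => ?_
  rw [← avg_eq n (fun y => pd n V i y ^ 2) x r hr,
    ← avg_eq n (fun y => pd n V i y ^ 2) x R (hr.trans_le hrR)]
  refine avg_mono n hn (fun y => pd n V i y ^ 2) ((pd_smooth n V i hVs).pow 2) ?_ x r R hr hrR ?_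
  · exact (pd_supp n V i hVc).comp_left (g := fun t : ℝ => t ^ 2) (by simp)
  · exact fun z hz => lap_sq n V hVs _ isOpen_ball hlap i z hz

lemma harm_mono (n : ℕ) (hn : 0 < n) (x : EuclideanSpace ℝ (Fin n)) (r ρ : ℝ)
    (hr : 0 < r) (hrR : r ≤ ρ) (v : EuclideanSpace ℝ (Fin n) → ℝ)
    (hsm : ContDiffOn ℝ (⊤ : ℕ∞) v (ball x ρ)) (hharm : ∀ y ∈ ball x ρ, lap n v y = 0)
    (hv2 : IntegrableOn (fun y => ‖gradient v y‖ ^ 2) (ball x ρ) volume) :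
    (r ^ n)⁻¹ * ∫ y in ball x r, ‖gradient v y‖ ^ 2 ≤
      (ρ ^ n)⁻¹ * ∫ y in ball x ρ, ‖gradient v y‖ ^ 2 := by
  rcases hrR.eq_or_lt with rfl | hlt
  · exact le_rfl
  have hρ : 0 < ρ := hr.trans hlt
  have ht : Tendsto (fun R : ℝ => (R ^ n)⁻¹ * ∫ y in ball x ρ, ‖gradient v y‖ ^ 2) (𝓝[<] ρ)
      (𝓝 ((ρ ^ n)⁻¹ * ∫ y in ball x ρ, ‖gradient v y‖ ^ 2)) := by
    apply Tendsto.mono_left _ nhdsWithin_le_nhds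
    exact (((continuous_pow n).tendsto ρ).inv₀ (by positivity)).mul_const _
  refine ge_of_tendsto ht ?_
  filter_upwards [Ioo_mem_nhdsLT hlt] with R hR
  refine (harm_mono_lt n hn x r R ρ hr hR.1.le hR.2 v hsm hharm).trans ?_
  have : 0 < R := hr.trans hR.1
  apply mul_le_mul_of_nonneg_left _ (by positivity)
  exact setIntegral_mono_set hv2 (Eventually.of_forall fun y => by positivity)
    (ball_subset_ball hR.2.le).eventuallyLE

/-- Decay estimate via harmonic comparison: if `v` is harmonic in `B_{x,ρ}` with smaller
Dirichlet energy than `u`, and `∫ |∇u - ∇v|² ≤ θ ∫ |∇u|²`, then for every `lam ≥ 1`,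
`(lam^{n-1}/ρ^{n-1}) ∫_{B_{x,ρ/lam}} |∇u|² ≤ (2θ lam^{n-1} + 2/lam) ρ^{1-n} ∫_{B_{x,ρ}} |∇u|²`. -/
theorem energy_decay_via_harmonic (n : ℕ) (x : EuclideanSpace ℝ (Fin n)) (ρ θ lam : ℝ)
    (hρ : 0 < ρ) (hθ : 0 < θ) (hlam : 1 ≤ lam)
    (u v : EuclideanSpace ℝ (Fin n) → ℝ)
    (hsm : ContDiffOn ℝ (⊤ : ℕ∞) v (ball x ρ)) (hharm : ∀ y ∈ ball x ρ, lap n v y = 0)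
    (hu2 : IntegrableOn (fun y => ‖gradient u y‖ ^ 2) (ball x ρ) volume)
    (hv2 : IntegrableOn (fun y => ‖gradient v y‖ ^ 2) (ball x ρ) volume)
    (huv2 : IntegrableOn (fun y => ‖gradient u y - gradient v y‖ ^ 2) (ball x ρ) volume)
    (hvle : (∫ y in ball x ρ, ‖gradient v y‖ ^ 2) ≤ ∫ y in ball x ρ, ‖gradient u y‖ ^ 2)
    (hclose : (∫ y in ball x ρ, ‖gradient u y - gradient v y‖ ^ 2) ≤
      θ * ∫ y in ball x ρ, ‖gradient u y‖ ^ 2) :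
    lam ^ (n - 1) / ρ ^ (n - 1) * ∫ y in ball x (ρ / lam), ‖gradient u y‖ ^ 2 ≤
      (2 * θ * lam ^ (n - 1) + 2 / lam) *
        (1 / ρ ^ (n - 1) * ∫ y in ball x ρ, ‖gradient u y‖ ^ 2) := by
  rcases Nat.eq_zero_or_pos n with rfl | hn
  · have h0 : ∀ y, gradient u y = 0 := fun y => Subsingleton.elim _ _
    simp [h0]
  have hl : 0 < lam := by linarith
  have hr : 0 < ρ / lam := by positivity
  have hrρ : ρ / lam ≤ ρ := div_le_self hρ.le hlam
  have hsub : ball x (ρ / lam) ⊆ ball x ρ := ball_subset_ball hrρ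
  have hm := harm_mono n hn x (ρ / lam) ρ hr hrρ v hsm hharm hv2
  set Iu := ∫ y in ball x ρ, ‖gradient u y‖ ^ 2
  set Iv := ∫ y in ball x ρ, ‖gradient v y‖ ^ 2
  set D := ∫ y in ball x ρ, ‖gradient u y - gradient v y‖ ^ 2
  have h1 : ∫ y in ball x (ρ / lam), ‖gradient u y‖ ^ 2 ≤
      2 * (∫ y in ball x (ρ / lam), ‖gradient v y‖ ^ 2) +
      2 * ∫ y in ball x (ρ / lam), ‖gradient u y - gradient v y‖ ^ 2 := by
    rw [← integral_const_mul, ← integral_const_mul, ← integral_add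
      ((hv2.mono_set hsub).const_mul 2) ((huv2.mono_set hsub).const_mul 2)]
    refine integral_mono (hu2.mono_set hsub)
      (((hv2.mono_set hsub).const_mul 2).add ((huv2.mono_set hsub).const_mul 2)) fun y => ?_
    have h := norm_add_le (gradient v y) (gradient u y - gradient v y)
    rw [add_sub_cancel] at h
    have h0 := norm_nonneg (gradient u y)
    simp only [Pi.add_apply]
    nlinarith [sq_nonneg (‖gradient v y‖ - ‖gradient u y - gradient v y‖)]
  have h2 : ∫ y in ball x (ρ / lam), ‖gradient u y - gradient v y‖ ^ 2 ≤ D :=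
    setIntegral_mono_set huv2 (Eventually.of_forall fun y => by positivity) hsub.eventuallyLE
  have h3 : (∫ y in ball x (ρ / lam), ‖gradient v y‖ ^ 2) ≤ (lam ^ n)⁻¹ * Iv := by
    rw [div_pow, inv_div, div_mul_eq_mul_div, div_le_iff₀ (by positivity)] at hm
    have e : (ρ ^ n)⁻¹ * Iv * ρ ^ n = Iv := by field_simp
    rw [e] at hm
    rw [inv_mul_eq_div, le_div_iff₀ (by positivity)]
    linarith
  have h4 : (lam ^ n)⁻¹ * Iv ≤ (lam ^ n)⁻¹ * Iu := by gcongr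
  have h5 : ∫ y in ball x (ρ / lam), ‖gradient u y‖ ^ 2 ≤
      2 * ((lam ^ n)⁻¹ * Iu) + 2 * (θ * Iu) := by linarith
  calc _ ≤ lam ^ (n - 1) / ρ ^ (n - 1) * (2 * ((lam ^ n)⁻¹ * Iu) + 2 * (θ * Iu)) := by gcongr
    _ = _ := by
      obtain ⟨m, rfl⟩ : ∃ m, n = m + 1 := ⟨n - 1, by omega⟩
      simp only [Nat.add_sub_cancel, pow_succ]
      field_simp
      ring
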